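/- arXiv:1311.6018 — 2 statements merged into one kernel-verified Lean document; each statement's English description precedes it below -/
import Mathlib

section
/- Let X = (X₁,...,X_ν) ~ N_ν(0, Λ) with Λ = diag(λ₁,...,λ_ν), λ_n > 0, truncated to the Euclidean ball B(ρ) = {x : xᵀx < ρ}. Then for all n ≠ m, cov(X_n², X_m²) ≤ 0 under the truncated distribution. -/
/-- Standard normal density. -/
noncomputable def stdPhi (t : ℝ) : ℝ := (Real.sqrt (2 * Real.pi))⁻¹ * Real.exp (-(t ^ 2) / 2)

open MeasureTheory Set

/-- A weighted one-dimensional Brunn–Minkowski inequality for sets and intervals centred at `0`. -/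
lemma volume_add_le_of_centred {A B C : Set ℝ} {α β : ℝ} (hα : 0 < α) (hβ : 0 < β)
    (hA : A.Nonempty) (hB : B.Nonempty)
    (hC : ∀ x ∈ A, ∀ y ∈ B, Icc (-(α * |x| + β * |y|)) (α * |x| + β * |y|) ⊆ C) :
    ENNReal.ofReal α * volume A + ENNReal.ofReal β * volume B ≤ volume C := by
  by_cases hV : volume C = ⊤
  · simp [hV]
  obtain ⟨V, hV0, hVC⟩ : ∃ V : ℝ, 0 ≤ V ∧ volume C = ENNReal.ofReal V :=
    ⟨(volume C).toReal, ENNReal.toReal_nonneg, (ENNReal.ofReal_toReal hV).symm⟩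
  have key : ∀ x ∈ A, ∀ y ∈ B, 2 * (α * |x| + β * |y|) ≤ V := by
    intro x hx y hy
    have h := measure_mono (μ := volume) (hC x hx y hy)
    rw [Real.volume_Icc, hVC, ENNReal.ofReal_le_ofReal_iff hV0] at h
    linarith
  have bound : ∀ (S : Set ℝ) (γ W : ℝ), 0 < γ → S.Nonempty → (∀ x ∈ S, 2 * (γ * |x|) ≤ W) →
      ∃ a : ℝ, 0 ≤ a ∧ volume S = ENNReal.ofReal a ∧ γ * a ≤ W := by
    intro S γ W hγ hS h
    have hsub : S ⊆ Icc (-(W / (2 * γ))) (W / (2 * γ)) := by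
      intro x hx
      rw [mem_Icc, ← abs_le, le_div_iff₀ (by positivity)]
      linarith [h x hx]
    have hW : 0 ≤ W := by
      obtain ⟨x, hx⟩ := hS
      exact le_trans (by positivity) (h x hx)
    have hle := measure_mono (μ := volume) hsub
    rw [Real.volume_Icc] at hle
    have hfin : volume S ≠ ⊤ := ne_top_of_le_ne_top ENNReal.ofReal_ne_top hle
    refine ⟨(volume S).toReal, ENNReal.toReal_nonneg, (ENNReal.ofReal_toReal hfin).symm, ?_⟩
    have h2 := ENNReal.toReal_le_of_le_ofReal (by rw [sub_neg_eq_add]; positivity) hle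
    have h3 : W / (2 * γ) - -(W / (2 * γ)) = W / γ := by field_simp; ring
    rw [h3, le_div_iff₀ hγ] at h2
    linarith
  have hAy : ∀ y ∈ B, ∃ a : ℝ, 0 ≤ a ∧ volume A = ENNReal.ofReal a ∧
      α * a ≤ V - 2 * (β * |y|) := fun y hy =>
    bound A α _ hα hA fun x hx => by linarith [key x hx y hy]
  obtain ⟨y₀, hy₀⟩ := id hB
  obtain ⟨a, ha, hvA, -⟩ := hAy y₀ hy₀
  obtain ⟨b, hb, hvB, hab⟩ := bound B β (V - α * a) hβ hB fun y hy => by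
    obtain ⟨a', ha', hvA', h⟩ := hAy y hy
    have : a' = a := by
      rw [hvA] at hvA'
      exact ((ENNReal.ofReal_eq_ofReal_iff ha ha').1 hvA').symm
    subst this
    linarith
  rw [hvA, hvB, hVC, ← ENNReal.ofReal_mul hα.le, ← ENNReal.ofReal_mul hβ.le,
    ← ENNReal.ofReal_add (by positivity) (by positivity)]
  exact ENNReal.ofReal_le_ofReal (by linarith)

lemma integral_add_le_of_radial {f g h : ℝ → ℝ} {α β : ℝ} (hα : 0 < α) (hβ : 0 < β)
    (hαβ : α + β = 1) (hf : Integrable f) (hg : Integrable g) (hh : Integrable h)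
    (hf0 : ∀ x, 0 ≤ f x) (hg0 : ∀ x, 0 ≤ g x) (hh0 : ∀ x, 0 ≤ h x)
    (hf1 : ∀ x, f x ≤ 1) (hg1 : ∀ x, g x ≤ 1) (hf01 : f 0 = 1) (hg01 : g 0 = 1)
    (hmono : ∀ x y, |x| ≤ |y| → h y ≤ h x)
    (hfgh : ∀ x y, f x ^ α * g y ^ β ≤ h (α * |x| + β * |y|)) :
    α * (∫ x, f x) + β * (∫ x, g x) ≤ ∫ x, h x := by
  have level : ∀ t ∈ Ioi (0 : ℝ), ENNReal.ofReal α * volume {x | t < f x} +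
      ENNReal.ofReal β * volume {x | t < g x} ≤ volume {x | t < h x} := by
    intro t ht
    have ht : 0 < t := ht
    by_cases h1 : t < 1
    · refine volume_add_le_of_centred hα hβ ⟨0, by simpa [hf01]⟩ ⟨0, by simpa [hg01]⟩ ?_
      intro x hx y hy z hz
      have hx : t < f x := hx
      have hy : t < g y := hy
      have e : t = t ^ α * t ^ β := by rw [← Real.rpow_add ht, hαβ, Real.rpow_one]
      have h2 : t < f x ^ α * g y ^ β := by
        calc t = t ^ α * t ^ β := e
          _ < _ := mul_lt_mul'' (Real.rpow_lt_rpow ht.le hx hα) (Real.rpow_lt_rpow ht.le hy hβ)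
            (by positivity) (by positivity)
      refine lt_of_lt_of_le h2 ((hfgh x y).trans (hmono _ _ ?_))
      rw [abs_of_nonneg (a := α * |x| + β * |y|) (by positivity)]
      exact abs_le.2 hz
    · have e1 : {x | t < f x} = ∅ := by
        ext x; simpa using (hf1 x).trans (not_lt.1 h1)
      have e2 : {x | t < g x} = ∅ := by
        ext x; simpa using (hg1 x).trans (not_lt.1 h1)
      simp [e1, e2]
  have hlin : ENNReal.ofReal α * (∫⁻ x, ENNReal.ofReal (f x)) +
      ENNReal.ofReal β * (∫⁻ x, ENNReal.ofReal (g x)) ≤ ∫⁻ x, ENNReal.ofReal (h x) := by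
    rw [lintegral_eq_lintegral_meas_lt volume (.of_forall hf0) hf.1.aemeasurable,
      lintegral_eq_lintegral_meas_lt volume (.of_forall hg0) hg.1.aemeasurable,
      lintegral_eq_lintegral_meas_lt volume (.of_forall hh0) hh.1.aemeasurable,
      ← lintegral_const_mul' _ _ ENNReal.ofReal_ne_top,
      ← lintegral_const_mul' _ _ ENNReal.ofReal_ne_top, ← lintegral_add_left]
    · exact setLIntegral_mono' measurableSet_Ioi level
    · refine Measurable.const_mul (Antitone.measurable fun s t hst => ?_) _
      exact measure_mono fun x hx => lt_of_le_of_lt hst hx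
  rw [← ofReal_integral_eq_lintegral_ofReal hf (.of_forall hf0),
    ← ofReal_integral_eq_lintegral_ofReal hg (.of_forall hg0),
    ← ofReal_integral_eq_lintegral_ofReal hh (.of_forall hh0), ← ENNReal.ofReal_mul hα.le,
    ← ENNReal.ofReal_mul hβ.le, ← ENNReal.ofReal_add
      (mul_nonneg hα.le (integral_nonneg hf0)) (mul_nonneg hβ.le (integral_nonneg hg0)),
    ENNReal.ofReal_le_ofReal_iff (integral_nonneg hh0)] at hlin
  exact hlin

/-- The Prékopa–Leindler inequality on the line, for functions maximal at `0`. -/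
lemma prekopa_leindler_of_radial {f g h : ℝ → ℝ} {α β : ℝ} (hα : 0 < α) (hβ : 0 < β)
    (hαβ : α + β = 1) (hf : Integrable f) (hg : Integrable g) (hh : Integrable h)
    (hf0 : ∀ x, 0 ≤ f x) (hg0 : ∀ x, 0 ≤ g x) (hh0 : ∀ x, 0 ≤ h x)
    (hf1 : ∀ x, f x ≤ f 0) (hg1 : ∀ x, g x ≤ g 0)
    (hmono : ∀ x y, |x| ≤ |y| → h y ≤ h x)
    (hfgh : ∀ x y, f x ^ α * g y ^ β ≤ h (α * |x| + β * |y|)) :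
    (∫ x, f x) ^ α * (∫ x, g x) ^ β ≤ ∫ x, h x := by
  rcases (hf0 0).eq_or_lt with hf00 | hfpos
  · have : ∀ x, f x = 0 := fun x => le_antisymm ((hf1 x).trans hf00.symm.le) (hf0 x)
    simpa [this, Real.zero_rpow hα.ne'] using integral_nonneg (μ := volume) hh0
  rcases (hg0 0).eq_or_lt with hg00 | hgpos
  · have : ∀ x, g x = 0 := fun x => le_antisymm ((hg1 x).trans hg00.symm.le) (hg0 x)
    simpa [this, Real.zero_rpow hβ.ne'] using integral_nonneg (μ := volume) hh0
  have hc : 0 < f 0 ^ α * g 0 ^ β := by positivity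
  have H := integral_add_le_of_radial (f := fun x => f x / f 0) (g := fun x => g x / g 0)
    (h := fun x => h x / (f 0 ^ α * g 0 ^ β)) hα hβ hαβ (hf.div_const _) (hg.div_const _)
    (hh.div_const _) (fun x => div_nonneg (hf0 x) hfpos.le) (fun x => div_nonneg (hg0 x) hgpos.le)
    (fun x => div_nonneg (hh0 x) hc.le) (fun x => (div_le_one hfpos).2 (hf1 x))
    (fun x => (div_le_one hgpos).2 (hg1 x)) (div_self hfpos.ne') (div_self hgpos.ne')
    (fun x y hxy => div_le_div_of_nonneg_right (hmono x y hxy) hc.le)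
    (fun x y => by
      rw [Real.div_rpow (hf0 x) hfpos.le, Real.div_rpow (hg0 y) hgpos.le, div_mul_div_comm]
      exact div_le_div_of_nonneg_right (hfgh x y) hc.le)
  simp only [integral_div] at H
  have G := (Real.geom_mean_le_arith_mean2_weighted hα.le hβ.le
    (div_nonneg (integral_nonneg hf0) hfpos.le)
    (div_nonneg (integral_nonneg hg0) hgpos.le) hαβ).trans H
  rw [Real.div_rpow (integral_nonneg hf0) hfpos.le, Real.div_rpow (integral_nonneg hg0) hgpos.le,
    div_mul_div_comm] at G
  exact (div_le_div_iff_of_pos_right hc).1 G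

/-- If a symmetrised product inequality holds pointwise, it holds for the integrals. -/
lemma integral_mul_integral_le_of_symm {a b c d : ℝ → ℝ} (ha : Integrable a) (hb : Integrable b)
    (hc : Integrable c) (hd : Integrable d)
    (h : ∀ x y, a x * b y + a y * b x ≤ c x * d y + c y * d x) :
    (∫ x, a x) * (∫ x, b x) ≤ (∫ x, c x) * (∫ x, d x) := by
  have key : ∀ {a b : ℝ → ℝ}, Integrable a → Integrable b →
      Integrable (fun z : ℝ × ℝ => a z.1 * b z.2 + a z.2 * b z.1) ∧
      ∫ z : ℝ × ℝ, (a z.1 * b z.2 + a z.2 * b z.1) = 2 * ((∫ x, a x) * ∫ x, b x) := by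
    intro a b ha hb
    have h1 : Integrable (fun z : ℝ × ℝ => a z.1 * b z.2) := ha.mul_prod hb
    have h2 : Integrable (fun z : ℝ × ℝ => b z.1 * a z.2) := hb.mul_prod ha
    have h2' : Integrable (fun z : ℝ × ℝ => a z.2 * b z.1) := by simpa only [mul_comm] using h2
    refine ⟨h1.add h2', ?_⟩
    rw [integral_add h1 h2']
    have e1 : ∫ z : ℝ × ℝ, a z.1 * b z.2 = (∫ x, a x) * ∫ x, b x := integral_prod_mul a b
    have e2 : ∫ z : ℝ × ℝ, b z.1 * a z.2 = (∫ x, b x) * ∫ x, a x := integral_prod_mul b a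
    simp only [mul_comm (b _)] at e2
    rw [e1, e2]; ring
  obtain ⟨i1, e1⟩ := key ha hb
  obtain ⟨i2, e2⟩ := key hc hd
  have := integral_mono i1 i2 fun z => h z.1 z.2
  rw [e1, e2] at this
  linarith

/-- The integral of a product function over the Euclidean ball of squared radius `s`. -/
noncomputable def ballIntegral {k : ℕ} (w : Fin k → ℝ → ℝ) (s : ℝ) : ℝ :=
  ∫ x in {x : Fin k → ℝ | ∑ i, x i ^ 2 < s}, ∏ i, w i (x i)

section ballIntegral

variable {k : ℕ}

lemma measurableSet_sum_sq_lt (s : ℝ) : MeasurableSet {x : Fin k → ℝ | ∑ i, x i ^ 2 < s} :=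
  measurableSet_lt (by fun_prop) measurable_const

lemma integrable_prod_apply {w : Fin k → ℝ → ℝ} (hw : ∀ i, Integrable (w i)) :
    Integrable fun x : Fin k → ℝ => ∏ i, w i (x i) :=
  Integrable.fintype_prod hw

lemma ballIntegral_nonneg {w : Fin k → ℝ → ℝ} (hw : ∀ i x, 0 ≤ w i x) (s : ℝ) :
    0 ≤ ballIntegral w s :=
  integral_nonneg fun x => Finset.prod_nonneg fun i _ => hw i (x i)

lemma ballIntegral_mono {w : Fin k → ℝ → ℝ} (hw : ∀ i x, 0 ≤ w i x)
    (hi : ∀ i, Integrable (w i)) : Monotone (ballIntegral w) := fun _ _ hst =>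
  setIntegral_mono_set (integrable_prod_apply hi).integrableOn
    (.of_forall fun x => Finset.prod_nonneg fun i _ => hw i (x i))
    (LE.le.eventuallyLE fun _ hx => lt_of_lt_of_le hx hst)

lemma ballIntegral_succAbove {w : Fin (k + 1) → ℝ → ℝ} (hi : ∀ i, Integrable (w i))
    (j : Fin (k + 1)) (s : ℝ) :
    ballIntegral w s =
      ∫ z, w j z * ballIntegral (fun i => w (j.succAbove i)) (s - z ^ 2) := by
  have hmp := (volume_preserving_piFinSuccAbove (fun _ : Fin (k + 1) => ℝ) j).symm
  have hI := (integrable_prod_apply hi).indicator (measurableSet_sum_sq_lt s)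
  rw [ballIntegral, ← integral_indicator (measurableSet_sum_sq_lt s),
    ← hmp.integral_comp (MeasurableEquiv.measurableEmbedding _), Measure.volume_eq_prod,
    integral_prod]
  · refine integral_congr_ae (.of_forall fun z => ?_)
    simp only
    rw [ballIntegral, ← integral_indicator (measurableSet_sum_sq_lt _), ← integral_const_mul]
    refine integral_congr_ae (.of_forall fun y => ?_)
    have hsymm : (MeasurableEquiv.piFinSuccAbove (fun _ : Fin (k + 1) => ℝ) j).symm (z, y) =
        j.insertNth z y := rfl
    simp only [hsymm]
    simp [indicator, Fin.sum_univ_succAbove _ j, Fin.prod_univ_succAbove _ j,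
      lt_sub_iff_add_lt']
  · exact hmp.integrable_comp_of_integrable hI

lemma integrable_mul_comp_sub_sq {w H : ℝ → ℝ} (hw : Integrable w) (hH : Monotone H)
    (hH0 : ∀ s, 0 ≤ H s) (s : ℝ) : Integrable fun z => w z * H (s - z ^ 2) := by
  refine hw.mul_bdd (c := H s) (hH.measurable.comp (by fun_prop)).aestronglyMeasurable
    (.of_forall fun z => ?_)
  rw [Real.norm_of_nonneg (hH0 _)]
  exact hH (by linarith [sq_nonneg z])

end ballIntegral

/-- Log-concavity, in multiplicative form. -/
def MulLogConcave (G : ℝ → ℝ) : Prop :=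
  ∀ α β s t : ℝ, 0 < α → 0 < β → α + β = 1 → G s ^ α * G t ^ β ≤ G (α * s + β * t)

lemma MulLogConcave.mul_le_mul {G : ℝ → ℝ} (hG : MulLogConcave G) (h0 : ∀ s, 0 ≤ G s)
    {a b c d : ℝ} (hab : a ≤ b) (hac : a ≤ c) (h : a + d = b + c) : G a * G d ≤ G b * G c := by
  rcases hab.eq_or_lt with rfl | hab
  · obtain rfl : d = c := by linarith
    rfl
  rcases hac.eq_or_lt with rfl | hac
  · obtain rfl : d = b := by linarith
    rw [mul_comm]
  have hda : 0 < d - a := by linarith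
  set β := (b - a) / (d - a) with hβ
  set α := (c - a) / (d - a) with hα
  have hβ0 : 0 < β := div_pos (by linarith) hda
  have hα0 : 0 < α := div_pos (by linarith) hda
  have h1 : α + β = 1 := by rw [hα, hβ]; field_simp; linarith
  have eβ : β * (d - a) = b - a := div_mul_cancel₀ _ hda.ne'
  have eb : α * a + β * d = b := by
    have : α = 1 - β := by linarith
    rw [this]; linarith
  have ec : β * a + α * d = c := by
    have : α = 1 - β := by linarith
    rw [this]; linarith
  have H1 := hG α β a d hα0 hβ0 h1
  have H2 := hG β α a d hβ0 hα0 (by linarith)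
  rw [eb] at H1
  rw [ec] at H2
  have pa := h0 a
  have pd := h0 d
  have ea : G a ^ α * G a ^ β = G a := by
    rw [← Real.rpow_add_of_nonneg pa hα0.le hβ0.le, h1, Real.rpow_one]
  have ed : G d ^ α * G d ^ β = G d := by
    rw [← Real.rpow_add_of_nonneg pd hα0.le hβ0.le, h1, Real.rpow_one]
  calc G a * G d = (G a ^ α * G a ^ β) * (G d ^ α * G d ^ β) := by rw [ea, ed]
    _ = (G a ^ α * G d ^ β) * (G a ^ β * G d ^ α) := by ring
    _ ≤ G b * G c := _root_.mul_le_mul H1 H2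
      (mul_nonneg (Real.rpow_nonneg pa _) (Real.rpow_nonneg pd _)) (h0 b)

lemma gaussian_rpow_mul_rpow_le {c b : ℝ} (hc : 0 < c) (hb : 0 < b) {α β : ℝ} (hα : 0 < α)
    (hβ : 0 < β) (hαβ : α + β = 1) (x y : ℝ) :
    (c * Real.exp (-b * x ^ 2)) ^ α * (c * Real.exp (-b * y ^ 2)) ^ β ≤
      c * Real.exp (-b * (α * x + β * y) ^ 2) := by
  rw [Real.mul_rpow hc.le (Real.exp_pos _).le, Real.mul_rpow hc.le (Real.exp_pos _).le,
    ← Real.exp_mul, ← Real.exp_mul, mul_mul_mul_comm, ← Real.rpow_add hc, hαβ, Real.rpow_one,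
    ← Real.exp_add]
  have : (α * x + β * y) ^ 2 ≤ α * x ^ 2 + β * y ^ 2 := by
    obtain rfl : β = 1 - α := by linarith
    nlinarith [mul_nonneg (mul_pos hα hβ).le (sq_nonneg (x - y))]
  gcongr
  nlinarith

lemma mulLogConcave_integral_gaussian_mul {c b : ℝ} (hc : 0 < c) (hb : 0 < b) {G : ℝ → ℝ}
    (hG : MulLogConcave G) (hG0 : ∀ s, 0 ≤ G s) (hGm : Monotone G) :
    MulLogConcave fun s => ∫ z, c * Real.exp (-b * z ^ 2) * G (s - z ^ 2) := by
  intro α β s t hα hβ hαβ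
  have hI : Integrable fun z : ℝ => c * Real.exp (-b * z ^ 2) :=
    (integrable_exp_neg_mul_sq hb).const_mul c
  have hanti : ∀ r x y, |x| ≤ |y| → c * Real.exp (-b * y ^ 2) * G (r - y ^ 2) ≤
      c * Real.exp (-b * x ^ 2) * G (r - x ^ 2) := by
    intro r x y hxy
    have hsq : x ^ 2 ≤ y ^ 2 := sq_le_sq.2 hxy
    refine mul_le_mul ?_ (hGm (by linarith)) (hG0 _) (by positivity)
    refine mul_le_mul_of_nonneg_left (Real.exp_le_exp.2 ?_) hc.le
    nlinarith
  have hnn : ∀ r x, 0 ≤ c * Real.exp (-b * x ^ 2) * G (r - x ^ 2) := fun r x =>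
    mul_nonneg (by positivity) (hG0 _)
  refine prekopa_leindler_of_radial hα hβ hαβ (integrable_mul_comp_sub_sq hI hGm hG0 s)
    (integrable_mul_comp_sub_sq hI hGm hG0 t) (integrable_mul_comp_sub_sq hI hGm hG0 _)
    (hnn s) (hnn t) (hnn _) (fun x => hanti s 0 x (by simp)) (fun x => hanti t 0 x (by simp))
    (hanti _) fun x y => ?_
  rw [Real.mul_rpow (by positivity) (hG0 _), Real.mul_rpow (by positivity) (hG0 _),
    mul_mul_mul_comm, ← sq_abs x, ← sq_abs y]
  refine mul_le_mul (gaussian_rpow_mul_rpow_le hc hb hα hβ hαβ _ _) ?_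
    (mul_nonneg (Real.rpow_nonneg (hG0 _) _) (Real.rpow_nonneg (hG0 _) _)) (by positivity)
  refine (hG α β _ _ hα hβ hαβ).trans (hGm ?_)
  obtain rfl : β = 1 - α := by linarith
  nlinarith [mul_nonneg (mul_pos hα hβ).le (sq_nonneg (|x| - |y|))]

lemma mulLogConcave_ballIntegral {k : ℕ} {c b : Fin k → ℝ} (hc : ∀ i, 0 < c i)
    (hb : ∀ i, 0 < b i) :
    MulLogConcave (ballIntegral fun i x => c i * Real.exp (-b i * x ^ 2)) := by
  induction k with
  | zero =>
    intro α β s t hα hβ hαβ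
    have h : ∀ r, ballIntegral (fun (i : Fin 0) x => c i * Real.exp (-b i * x ^ 2)) r =
        if 0 < r then 1 else 0 := by
      intro r
      by_cases hr : 0 < r <;> simp [ballIntegral, hr, Measure.real, volume_pi]
    simp only [h]
    by_cases hs : 0 < s <;> by_cases ht : 0 < t
    · have : 0 < α * s + β * t := by positivity
      simp [hs, ht, this]
    all_goals
      simp only [hs, ht, if_true, if_false, Real.zero_rpow hα.ne', Real.zero_rpow hβ.ne', zero_mul,
        mul_zero]
      split_ifs <;> simp
  | succ k ih =>
    have hI : ∀ i, Integrable fun x : ℝ => c i * Real.exp (-b i * x ^ 2) := fun i =>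
      (integrable_exp_neg_mul_sq (hb i)).const_mul _
    have h0 : ∀ i (x : ℝ), 0 ≤ c i * Real.exp (-b i * x ^ 2) := fun i x =>
      mul_nonneg (hc i).le (Real.exp_pos _).le
    have := mulLogConcave_integral_gaussian_mul (hc 0) (hb 0)
      (ih (fun i => hc (Fin.succAbove 0 i)) fun i => hb (Fin.succAbove 0 i))
      (ballIntegral_nonneg fun i => h0 _) (ballIntegral_mono (fun i => h0 _) fun i => hI _)
    rw [funext (ballIntegral_succAbove hI 0)]
    exact this

/-- The function `s ↦ ∫ x² q(x) G(s - x²) / ∫ q(x) G(s - x²)` is monotone, in product form. -/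
lemma integral_sq_mul_mul_integral_le {q G : ℝ → ℝ} (hq0 : ∀ x, 0 ≤ q x) (hq : Integrable q)
    (hq2 : Integrable fun x => x ^ 2 * q x) (hG : MulLogConcave G) (hG0 : ∀ s, 0 ≤ G s)
    (hGm : Monotone G) {s t : ℝ} (hst : s ≤ t) :
    (∫ x, x ^ 2 * q x * G (s - x ^ 2)) * (∫ x, q x * G (t - x ^ 2)) ≤
      (∫ x, q x * G (s - x ^ 2)) * (∫ x, x ^ 2 * q x * G (t - x ^ 2)) := by
  refine integral_mul_integral_le_of_symm (integrable_mul_comp_sub_sq hq2 hGm hG0 s)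
    (integrable_mul_comp_sub_sq hq hGm hG0 t) (integrable_mul_comp_sub_sq hq hGm hG0 s)
    (integrable_mul_comp_sub_sq hq2 hGm hG0 t) fun x y => ?_
  have key : 0 ≤ (x ^ 2 - y ^ 2) *
      (G (s - y ^ 2) * G (t - x ^ 2) - G (s - x ^ 2) * G (t - y ^ 2)) := by
    rcases le_total (y ^ 2) (x ^ 2) with h | h
    · exact mul_nonneg (by linarith) (sub_nonneg.2
        (hG.mul_le_mul hG0 (by linarith) (by linarith) (by ring)))
    · exact mul_nonneg_of_nonpos_of_nonpos (by linarith) (sub_nonpos.2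
        (hG.mul_le_mul hG0 (by linarith) (by linarith) (by ring)))
  nlinarith [mul_nonneg (mul_nonneg (hq0 x) (hq0 y)) key]

lemma integral_sq_mul_le_of_ratio {p M N : ℝ → ℝ} (hp0 : ∀ x, 0 ≤ p x) (hp : Integrable p)
    (hp2 : Integrable fun x => x ^ 2 * p x) (hM0 : ∀ s, 0 ≤ M s) (hMm : Monotone M)
    (hN0 : ∀ s, 0 ≤ N s) (hNm : Monotone N)
    (hMN : ∀ s t, s ≤ t → N s * M t ≤ M s * N t) (ρ : ℝ) :
    (∫ x, x ^ 2 * p x * N (ρ - x ^ 2)) * (∫ x, p x * M (ρ - x ^ 2)) ≤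
      (∫ x, x ^ 2 * p x * M (ρ - x ^ 2)) * (∫ x, p x * N (ρ - x ^ 2)) := by
  refine integral_mul_integral_le_of_symm (integrable_mul_comp_sub_sq hp2 hNm hN0 ρ)
    (integrable_mul_comp_sub_sq hp hMm hM0 ρ) (integrable_mul_comp_sub_sq hp2 hMm hM0 ρ)
    (integrable_mul_comp_sub_sq hp hNm hN0 ρ) fun x y => ?_
  have key : 0 ≤ (x ^ 2 - y ^ 2) *
      (M (ρ - x ^ 2) * N (ρ - y ^ 2) - N (ρ - x ^ 2) * M (ρ - y ^ 2)) := by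
    rcases le_total (y ^ 2) (x ^ 2) with h | h
    · exact mul_nonneg (by linarith) (sub_nonneg.2 (hMN _ _ (by linarith)))
    · refine mul_nonneg_of_nonpos_of_nonpos (by linarith) (sub_nonpos.2 ?_)
      linarith [hMN (ρ - y ^ 2) (ρ - x ^ 2) (by linarith)]
  nlinarith [mul_nonneg (mul_nonneg (hp0 x) (hp0 y)) key]

/-- Multiply the `n`-th factor by `f` and the `m`-th one by `g`. -/
def weightTwo {k : ℕ} (n m : Fin k) (f g : ℝ → ℝ) (w : Fin k → ℝ → ℝ) (i : Fin k) (x : ℝ) : ℝ :=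
  (if i = n then f x else 1) * (if i = m then g x else 1) * w i x

lemma prod_weightTwo {k : ℕ} (n m : Fin k) (f g : ℝ → ℝ) (w : Fin k → ℝ → ℝ) (x : Fin k → ℝ) :
    ∏ i, weightTwo n m f g w i (x i) = f (x n) * g (x m) * ∏ i, w i (x i) := by
  simp only [weightTwo, Finset.prod_mul_distrib, Finset.prod_ite_eq', Finset.mem_univ, if_true]

lemma ballIntegral_weightTwo {k : ℕ} (n : Fin (k + 2)) (m : Fin (k + 1)) {f g : ℝ → ℝ}
    {w : Fin (k + 2) → ℝ → ℝ}
    (hw : ∀ i, Integrable (w i)) (hf : Integrable fun x => f x * w n x)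
    (hg : Integrable fun x => g x * w (n.succAbove m) x) (ρ : ℝ) :
    ballIntegral (weightTwo n (n.succAbove m) f g w) ρ =
      ∫ u, f u * w n u * ∫ v, g v * w (n.succAbove m) v *
        ballIntegral (fun i => w (n.succAbove (m.succAbove i))) (ρ - u ^ 2 - v ^ 2) := by
  have hi : ∀ i, Integrable (weightTwo n (n.succAbove m) f g w i) := by
    intro i
    unfold weightTwo
    by_cases h1 : i = n
    · subst h1; simpa [(Fin.succAbove_ne i m).symm] using hf
    · by_cases h2 : i = n.succAbove m
      · subst h2; simpa [h1] using hg
      · simpa [h1, h2] using hw i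
  rw [ballIntegral_succAbove hi n]
  simp only [ballIntegral_succAbove (fun i => hi (n.succAbove i)) m]
  have hrest : (fun i => weightTwo n (n.succAbove m) f g w (n.succAbove (m.succAbove i))) =
      fun i => w (n.succAbove (m.succAbove i)) := by
    funext i x
    simp [weightTwo, Fin.succAbove_ne]
  rw [hrest]
  simp [weightTwo, Fin.succAbove_ne, (Fin.succAbove_ne n m).symm]

/-- Negative correlation of the squared coordinates of a Gaussian weight on a Euclidean ball. -/
lemma setIntegral_sq_mul_sq_le {ν : ℕ} {c b : Fin ν → ℝ} (hc : ∀ i, 0 < c i) (hb : ∀ i, 0 < b i)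
    {n m : Fin ν} (hnm : n ≠ m) (ρ : ℝ) :
    let B : Set (Fin ν → ℝ) := {x | ∑ i, x i ^ 2 < ρ}
    let d : (Fin ν → ℝ) → ℝ := fun x => ∏ i, c i * Real.exp (-b i * x i ^ 2)
    (∫ x in B, x n ^ 2 * x m ^ 2 * d x) * (∫ x in B, d x) ≤
      (∫ x in B, x n ^ 2 * d x) * (∫ x in B, x m ^ 2 * d x) := by
  intro B d
  obtain ⟨k, rfl⟩ : ∃ k, ν = k + 2 := by
    have h1 := n.2
    have h2 := m.2
    have h3 : n.1 ≠ m.1 := fun h => hnm (Fin.ext h)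
    exact ⟨ν - 2, by omega⟩
  obtain ⟨m, rfl⟩ := Fin.exists_succAbove_eq hnm.symm
  set w : Fin (k + 2) → ℝ → ℝ := fun i x => c i * Real.exp (-b i * x ^ 2) with hw
  have hI : ∀ i, Integrable (w i) := fun i => (integrable_exp_neg_mul_sq (hb i)).const_mul _
  have h0 : ∀ i x, 0 ≤ w i x := fun i x => mul_nonneg (hc i).le (Real.exp_pos _).le
  have hI2 : ∀ i, Integrable fun x => x ^ 2 * w i x := by
    intro i
    have h := (integrable_rpow_mul_exp_neg_mul_sq (hb i) (s := 2) (by norm_num)).const_mul (c i)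
    refine h.congr (.of_forall fun x => ?_)
    simp only [hw, Real.rpow_two]
    ring
  have hI1 : ∀ i, Integrable fun x => (fun _ : ℝ => (1 : ℝ)) x * w i x := by simpa using hI
  set G := ballIntegral fun i => w (n.succAbove (m.succAbove i))
  have hG : MulLogConcave G := mulLogConcave_ballIntegral (fun i => hc _) fun i => hb _
  have hG0 : ∀ s, 0 ≤ G s := ballIntegral_nonneg fun i => h0 _
  have hGm : Monotone G := ballIntegral_mono (fun i => h0 _) fun i => hI _
  have step := fun f g => ballIntegral_weightTwo (f := f) (g := g) n m (ρ := ρ) hI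
  have e : ∀ f g : ℝ → ℝ, ∫ x in B, f (x n) * g (x (n.succAbove m)) * d x =
      ballIntegral (weightTwo n (n.succAbove m) f g w) ρ := by
    intro f g
    simp only [ballIntegral, prod_weightTwo]
    rfl
  have monotone_integral : ∀ p : ℝ → ℝ, (∀ x, 0 ≤ p x) → Integrable p →
      Monotone fun s => ∫ v, p v * G (s - v ^ 2) := fun p hp0 hp s t hst =>
    integral_mono (integrable_mul_comp_sub_sq hp hGm hG0 s)
      (integrable_mul_comp_sub_sq hp hGm hG0 t) fun v =>
        mul_le_mul_of_nonneg_left (hGm (by linarith)) (hp0 v)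
  have h02 : ∀ x, 0 ≤ x ^ 2 * w (n.succAbove m) x := fun x => mul_nonneg (sq_nonneg x) (h0 _ x)
  have main := integral_sq_mul_le_of_ratio (h0 n) (hI n) (hI2 n)
    (M := fun s => ∫ v, w (n.succAbove m) v * G (s - v ^ 2))
    (N := fun s => ∫ v, v ^ 2 * w (n.succAbove m) v * G (s - v ^ 2))
    (fun s => integral_nonneg fun v => mul_nonneg (h0 _ _) (hG0 _))
    (monotone_integral _ (h0 _) (hI _))
    (fun s => integral_nonneg fun v => mul_nonneg (h02 v) (hG0 _))
    (monotone_integral _ h02 (hI2 _))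
    (fun s t hst => integral_sq_mul_mul_integral_le (h0 _) (hI _) (hI2 _) hG hG0 hGm hst) ρ
  have e22 := (e (fun x => x ^ 2) fun x => x ^ 2).trans (step _ _ (hI2 _) (hI2 _))
  have e21 := (e (fun x => x ^ 2) fun _ => 1).trans (step _ _ (hI2 _) (hI1 _))
  have e12 := (e (fun _ => 1) fun x => x ^ 2).trans (step _ _ (hI1 _) (hI2 _))
  have e11 := (e (fun _ => 1) fun _ => 1).trans (step _ _ (hI1 _) (hI1 _))
  simp only [one_mul, mul_one] at e22 e21 e12 e11
  rw [e22, e21, e12, e11]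
  exact main

/-- Covariance inequality for N_ν(0, Λ) truncated to the Euclidean ball B(ρ):
cov(X_n², X_m²) ≤ 0 for n ≠ m. -/
theorem stmt18 (ν : ℕ) (l : Fin ν → ℝ) (hl : ∀ i, 0 < l i) (ρ : ℝ) (hρ : 0 < ρ)
    (n m : Fin ν) (hnm : n ≠ m) :
    let B : Set (Fin ν → ℝ) := {x | ∑ i, x i ^ 2 < ρ}
    let dens : (Fin ν → ℝ) → ℝ :=
      fun x => ∏ i, (Real.sqrt (l i))⁻¹ * stdPhi ((Real.sqrt (l i))⁻¹ * x i)
    let Z : ℝ := ∫ x in B, dens x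
    (∫ x in B, x n ^ 2 * x m ^ 2 * (Z⁻¹ * dens x)) -
        (∫ x in B, x n ^ 2 * (Z⁻¹ * dens x)) * (∫ x in B, x m ^ 2 * (Z⁻¹ * dens x))
      ≤ 0 := by
  intro B dens Z
  have hs : ∀ i, 0 < Real.sqrt (l i) := fun i => Real.sqrt_pos.2 (hl i)
  have hdens : dens = fun x => ∏ i, ((Real.sqrt (l i))⁻¹ * (Real.sqrt (2 * Real.pi))⁻¹) *
      Real.exp (-((Real.sqrt (l i))⁻¹ ^ 2 / 2) * x i ^ 2) := by
    funext x
    refine Finset.prod_congr rfl fun i _ => ?_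
    rw [stdPhi, mul_assoc]
    congr 3
    ring
  have key := setIntegral_sq_mul_sq_le (c := fun i => (Real.sqrt (l i))⁻¹ *
      (Real.sqrt (2 * Real.pi))⁻¹) (b := fun i => (Real.sqrt (l i))⁻¹ ^ 2 / 2)
    (fun i => by have := hs i; positivity) (fun i => by have := hs i; positivity) hnm ρ
  have pull : ∀ f : (Fin ν → ℝ) → ℝ,
      ∫ x in B, f x * (Z⁻¹ * dens x) = Z⁻¹ * ∫ x in B, f x * dens x := by
    intro f
    rw [← integral_const_mul]
    exact integral_congr_ae (.of_forall fun x => by ring)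
  rw [pull fun x => x n ^ 2 * x m ^ 2, pull fun x => x n ^ 2, pull fun x => x m ^ 2]
  rcases eq_or_ne Z 0 with hZ | hZ
  · simp [hZ]
  have key' : (∫ x in B, x n ^ 2 * x m ^ 2 * dens x) * Z ≤
      (∫ x in B, x n ^ 2 * dens x) * (∫ x in B, x m ^ 2 * dens x) := by
    simpa only [Z, hdens] using key
  have h := mul_le_mul_of_nonneg_left key' (sq_nonneg Z⁻¹)
  have hZ1 : Z⁻¹ * Z = 1 := inv_mul_cancel₀ hZ
  have e : Z⁻¹ ^ 2 * ((∫ x in B, x n ^ 2 * x m ^ 2 * dens x) * Z) =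
      Z⁻¹ * ∫ x in B, x n ^ 2 * x m ^ 2 * dens x := by
    calc _ = Z⁻¹ * (∫ x in B, x n ^ 2 * x m ^ 2 * dens x) * (Z⁻¹ * Z) := by ring
      _ = _ := by rw [hZ1, mul_one]
  rw [e] at h
  linarith
end

section
/- Let X = (X₁,...,X_ν) ~ N_ν(0, Λ) with Λ = diag(λ₁,...,λ_ν), λ_n > 0, truncated to B(ρ) = {x : xᵀx < ρ}. Then for each n, var(X_n²) ≤ 2λ_n E(X_n²) under the truncated distribution. -/
open MeasureTheory
open scoped ENNReal

theorem volume_add_le_of_isCompact {K L C : Set ℝ} (hK : IsCompact K) (hL : IsCompact L)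
    (hK0 : K.Nonempty) (hL0 : L.Nonempty) (h : ∀ x ∈ K, ∀ y ∈ L, x + y ∈ C) :
    volume K + volume L ≤ volume C := by
  obtain ⟨k, hk, hkmax⟩ := hK.exists_isGreatest hK0
  obtain ⟨l, hl, hlmin⟩ := hL.exists_isLeast hL0
  have h1 : volume ((fun x => x + l) '' K) = volume K := by
    simp
  have h2 : volume ((fun x => k + x) '' L) = volume L := by
    simp
  have hd : ((fun x => x + l) '' K) ∩ ((fun x => k + x) '' L) ⊆ {k + l} := by
    rintro _ ⟨⟨x, hx, rfl⟩, ⟨y, hy, hxy⟩⟩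
    have := hkmax hx
    have := hlmin hy
    simp only [Set.mem_singleton_iff] at *
    linarith
  have h0 : volume (((fun x => x + l) '' K) ∩ ((fun x => k + x) '' L)) = 0 :=
    measure_mono_null hd (by simp)
  have hm : MeasurableSet ((fun x => k + x) '' L) :=
    (hL.image (by fun_prop)).measurableSet
  rw [← h1, ← h2, ← measure_union_add_inter _ hm, h0, add_zero]
  apply measure_mono
  rintro _ (⟨x, hx, rfl⟩ | ⟨x, hx, rfl⟩)
  · exact h x hx l hl
  · exact h k hk x hx

/-- Brunn-Minkowski inequality on the real line. -/
theorem volume_add_le_of_add_mem {A B C : Set ℝ} (hA : MeasurableSet A) (hB : MeasurableSet B)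
    (hA0 : A.Nonempty) (hB0 : B.Nonempty) (h : ∀ x ∈ A, ∀ y ∈ B, x + y ∈ C) :
    volume A + volume B ≤ volume C := by
  obtain ⟨a, ha⟩ := hA0
  obtain ⟨b, hb⟩ := hB0
  rw [hA.measure_eq_iSup_isCompact, hB.measure_eq_iSup_isCompact]
  simp only [iSup_and']
  refine ENNReal.biSup_add_biSup_le' ⟨∅, by simp, by simp⟩ ⟨∅, by simp, by simp⟩ ?_
  rintro K ⟨hKA, hK⟩ L ⟨hLB, hL⟩
  refine (add_le_add (measure_mono (Set.subset_insert a K))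
    (measure_mono (Set.subset_insert b L))).trans ?_
  refine volume_add_le_of_isCompact (hK.insert a) (hL.insert b) (by simp) (by simp) ?_
  intro x hx y hy
  exact h x (Set.insert_subset ha hKA hx) y (Set.insert_subset hb hLB hy)

theorem lintegral_add_le_of_prekopa_leindler {f g h : ℝ → ℝ} (hf : Measurable f)
    (hg : Measurable g) (hh : Measurable h)
    (hf0 : ∀ x, 0 ≤ f x) (hg0 : ∀ x, 0 ≤ g x) (hh0 : ∀ x, 0 ≤ h x)
    (hf1 : ∀ x, f x ≤ 1) (hg1 : ∀ x, g x ≤ 1)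
    (hfs : ∀ t < 1, ∃ x, t < f x) (hgs : ∀ t < 1, ∃ x, t < g x)
    (H : ∀ x y, f x * g y ≤ h (x + y) ^ 2) :
    (∫⁻ x, ENNReal.ofReal (f x)) + ∫⁻ x, ENNReal.ofReal (g x) ≤ ∫⁻ x, ENNReal.ofReal (h x) := by
  rw [lintegral_eq_lintegral_meas_lt volume (.of_forall hf0) hf.aemeasurable,
    lintegral_eq_lintegral_meas_lt volume (.of_forall hg0) hg.aemeasurable,
    lintegral_eq_lintegral_meas_lt volume (.of_forall hh0) hh.aemeasurable,
    ← lintegral_add_left]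
  · refine setLIntegral_mono' measurableSet_Ioi fun t ht => ?_
    have ht : 0 < t := ht
    rcases lt_or_ge t 1 with h1 | h1
    · refine volume_add_le_of_add_mem (measurableSet_lt measurable_const hf)
        (measurableSet_lt measurable_const hg) (hfs t h1) (hgs t h1) ?_
      intro x hx y hy
      have hx : t < f x := hx
      have hy : t < g y := hy
      have := H x y
      have h2 := hh0 (x + y)
      show t < h (x + y)
      by_contra hc
      nlinarith
    · have e1 : {a | t < f a} = ∅ := by
        ext x; simpa using (hf1 x).trans h1
      have e2 : {a | t < g a} = ∅ := by
        ext x; simpa using (hg1 x).trans h1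
      simp [e1, e2]
  · apply Antitone.measurable
    intro s t hst
    exact measure_mono fun x hx => lt_of_le_of_lt hst hx

theorem ennreal_four_mul_le_sq_add (a b : ℝ≥0∞) : 4 * (a * b) ≤ (a + b) ^ 2 := by
  rcases eq_or_ne a ⊤ with rfl | ha
  · simp
  rcases eq_or_ne b ⊤ with rfl | hb
  · simp
  lift a to NNReal using ha
  lift b to NNReal using hb
  norm_cast
  rw [← NNReal.coe_le_coe]
  push_cast
  nlinarith [sq_nonneg ((a : ℝ) - b)]

theorem prekopa_leindler_of_bddAbove {f g h : ℝ → ℝ} (hf : Measurable f) (hg : Measurable g)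
    (hh : Measurable h)
    (hf0 : ∀ x, 0 ≤ f x) (hg0 : ∀ x, 0 ≤ g x) (hh0 : ∀ x, 0 ≤ h x)
    (hfb : BddAbove (Set.range f)) (hgb : BddAbove (Set.range g))
    (H : ∀ x y, f x * g y ≤ h (x + y) ^ 2) :
    4 * ((∫⁻ x, ENNReal.ofReal (f x)) * ∫⁻ x, ENNReal.ofReal (g x))
      ≤ (∫⁻ x, ENNReal.ofReal (h x)) ^ 2 := by
  have key : ∀ (f : ℝ → ℝ), (∀ x, 0 ≤ f x) → BddAbove (Set.range f) →
      (∀ x, f x = 0) ∨ ∃ a > 0, (∀ x, f x ≤ a) ∧ ∀ t < a, ∃ x, t < f x := by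
    intro f hf0 hfb
    rcases le_or_gt (⨆ x, f x) 0 with h0 | h0
    · exact .inl fun x => le_antisymm ((le_ciSup hfb x).trans h0) (hf0 x)
    · exact .inr ⟨_, h0, fun x => le_ciSup hfb x, fun t ht => exists_lt_of_lt_ciSup ht⟩
  rcases key f hf0 hfb with h0 | ⟨a, ha, hfa, hfs⟩
  · simp [h0]
  rcases key g hg0 hgb with h0 | ⟨b, hb, hgb, hgs⟩
  · simp [h0]
  have hc : 0 < √(a * b) := Real.sqrt_pos.2 (mul_pos ha hb)
  have hc2 : √(a * b) ^ 2 = a * b := Real.sq_sqrt (mul_pos ha hb).le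
  set c := √(a * b)
  have N := lintegral_add_le_of_prekopa_leindler (f := fun x => a⁻¹ * f x) (g := fun x => b⁻¹ * g x)
    (h := fun x => c⁻¹ * h x) (by fun_prop) (by fun_prop) (by fun_prop)
    (fun x => mul_nonneg (by positivity) (hf0 x)) (fun x => mul_nonneg (by positivity) (hg0 x))
    (fun x => mul_nonneg (by positivity) (hh0 x))
    (fun x => by rw [inv_mul_le_iff₀ ha]; simpa using hfa x)
    (fun x => by rw [inv_mul_le_iff₀ hb]; simpa using hgb x)
    (fun t ht => by
      obtain ⟨x, hx⟩ := hfs (a * t) (by nlinarith)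
      exact ⟨x, by rwa [lt_inv_mul_iff₀ ha]⟩)
    (fun t ht => by
      obtain ⟨x, hx⟩ := hgs (b * t) (by nlinarith)
      exact ⟨x, by rwa [lt_inv_mul_iff₀ hb]⟩)
    (fun x y => by
      have e : a⁻¹ * f x * (b⁻¹ * g y) = (c ^ 2)⁻¹ * (f x * g y) := by
        rw [hc2]; field_simp
      rw [e, mul_pow, inv_pow]
      gcongr
      exact H x y)
  simp only [ENNReal.ofReal_mul (inv_pos.2 ha).le, ENNReal.ofReal_mul (inv_pos.2 hb).le,
    ENNReal.ofReal_mul (inv_pos.2 hc).le] at N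
  rw [lintegral_const_mul _ (by fun_prop), lintegral_const_mul _ (by fun_prop),
    lintegral_const_mul _ (by fun_prop)] at N
  have M := (ennreal_four_mul_le_sq_add _ _).trans (pow_le_pow_left₀ zero_le N 2)
  have e : ENNReal.ofReal a⁻¹ * ENNReal.ofReal b⁻¹ = ENNReal.ofReal c⁻¹ ^ 2 := by
    rw [← ENNReal.ofReal_mul (by positivity), ← ENNReal.ofReal_pow (by positivity), inv_pow, hc2,
      mul_inv]
  rw [mul_mul_mul_comm, e, mul_pow, mul_left_comm] at M
  refine (ENNReal.mul_le_mul_iff_right ?_ ?_).1 M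
  · have : 0 < c⁻¹ := by positivity
    simp [hc]
  · exact ENNReal.pow_ne_top ENNReal.ofReal_ne_top

/-- Prékopa-Leindler inequality on the real line, for the midpoint. -/
theorem prekopa_leindler_real {f g h : ℝ → ℝ≥0∞} (hf : Measurable f) (hg : Measurable g)
    (hh : Measurable h)
    (H : ∀ x y, f x * g y ≤ h (x + y) ^ 2) :
    4 * ((∫⁻ x, f x) * ∫⁻ x, g x) ≤ (∫⁻ x, h x) ^ 2 := by
  have key : ∀ f : ℝ → ℝ≥0∞, Measurable f →
      ∫⁻ x, f x = ⨆ N : ℕ, ∫⁻ x, min (f x) N := by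
    intro f hf
    rw [← lintegral_iSup (fun N => hf.min measurable_const)]
    · congr 1
      ext x
      have := ENNReal.iSup_natCast
      rw [← inf_iSup_eq, this, inf_top_eq]
    · intro m n hmn x
      exact min_le_min le_rfl (by exact_mod_cast hmn)
  have hr : ∀ (f : ℝ → ℝ≥0∞) (N : ℕ) x, ENNReal.ofReal (min (f x) N).toReal = min (f x) N :=
    fun f N x => ENNReal.ofReal_toReal (by simp)
  have hN : ∀ N : ℕ, 4 * ((∫⁻ x, min (f x) N) * ∫⁻ x, min (g x) N) ≤ (∫⁻ x, h x) ^ 2 := by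
    intro N
    have hb : ∀ f : ℝ → ℝ≥0∞, BddAbove (Set.range fun x => (min (f x) N).toReal) := by
      refine fun f => ⟨N, ?_⟩
      rintro _ ⟨x, rfl⟩
      exact ENNReal.toReal_le_of_le_ofReal (by simp) (by simp)
    have := prekopa_leindler_of_bddAbove (f := fun x => (min (f x) N).toReal)
        (g := fun x => (min (g x) N).toReal)
      (h := fun x => (min (h x) N).toReal) (by fun_prop) (by fun_prop) (by fun_prop)
      (by simp) (by simp) (by simp) (hb f) (hb g) ?_
    · simp only [hr] at this
      refine this.trans ?_
      gcongr
      exact min_le_left _ _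
    · intro x y
      rw [← ENNReal.toReal_mul, ← ENNReal.toReal_pow]
      refine ENNReal.toReal_mono (by simp) ?_
      rcases le_total (h (x + y)) N with h1 | h1
      · rw [min_eq_left h1]
        exact le_trans (mul_le_mul' (min_le_left _ _) (min_le_left _ _)) (H x y)
      · rw [min_eq_right h1, sq]
        exact mul_le_mul' (min_le_right _ _) (min_le_right _ _)
  rw [key f hf, key g hg, ENNReal.iSup_mul, ENNReal.mul_iSup]
  refine iSup_le fun i => ?_
  rw [ENNReal.mul_iSup, ENNReal.mul_iSup]
  refine iSup_le fun j => le_trans ?_ (hN (max i j))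
  gcongr <;> simp

theorem lintegral_Ioi_eq_exp (f : ℝ → ℝ≥0∞) {c : ℝ} (hc : 0 < c) :
    ∫⁻ x in Set.Ioi 0, f x
      = ∫⁻ u, ENNReal.ofReal (c * Real.exp (c * u)) * f (Real.exp (c * u)) := by
  have himg : (fun u => Real.exp (c * u)) '' Set.univ = Set.Ioi 0 := by
    ext x
    simp only [Set.image_univ, Set.mem_range, Set.mem_Ioi]
    constructor
    · rintro ⟨u, rfl⟩
      positivity
    · intro hx
      exact ⟨Real.log x / c, by rw [mul_div_cancel₀ _ hc.ne', Real.exp_log hx]⟩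
  have := lintegral_image_eq_lintegral_abs_deriv_mul (s := Set.univ)
    (f := fun u => Real.exp (c * u)) (f' := fun u => c * Real.exp (c * u)) MeasurableSet.univ
    (fun x _ => by
      have := ((hasDerivAt_id x).const_mul c).exp
      simp only [id, mul_one] at this
      rw [mul_comm c]
      exact this.hasDerivWithinAt)
    (fun x _ y _ hxy => by
      simpa [hc.ne'] using hxy) f
  rw [himg] at this
  rw [this, setLIntegral_univ]
  congr 1
  ext u
  rw [abs_of_pos (by positivity)]

theorem prekopa_leindler_geom_mean_Ioi {f g h : ℝ → ℝ≥0∞} (hf : Measurable f) (hg : Measurable g)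
    (hh : Measurable h)
    (H : ∀ x y z, 0 < x → 0 < y → 0 < z → z ^ 2 = x * y → f x * g y ≤ h z ^ 2) :
    (∫⁻ x in Set.Ioi 0, f x) * (∫⁻ x in Set.Ioi 0, g x) ≤ (∫⁻ x in Set.Ioi 0, h x) ^ 2 := by
  have P := prekopa_leindler_real (f := fun u => ENNReal.ofReal (Real.exp u) * f (Real.exp u))
    (g := fun u => ENNReal.ofReal (Real.exp u) * g (Real.exp u))
    (h := fun u => ENNReal.ofReal (Real.exp (2⁻¹ * u)) * h (Real.exp (2⁻¹ * u)))
    (by fun_prop) (by fun_prop) (by fun_prop) ?_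
  · rw [lintegral_Ioi_eq_exp f one_pos, lintegral_Ioi_eq_exp g one_pos,
      lintegral_Ioi_eq_exp h (c := 2⁻¹) (by norm_num)]
    simp only [one_mul, ENNReal.ofReal_mul (show (0 : ℝ) ≤ 2⁻¹ by norm_num), mul_assoc]
    rw [lintegral_const_mul _ (by fun_prop), mul_pow, ← ENNReal.ofReal_pow (by norm_num)]
    refine le_trans ?_ (mul_le_mul_right P _)
    rw [← mul_assoc]
    refine le_mul_of_one_le_left zero_le ?_
    rw [show (4 : ℝ≥0∞) = ENNReal.ofReal 4 by simp, ← ENNReal.ofReal_mul (by norm_num)]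
    norm_num
  · intro u v
    have e : Real.exp (2⁻¹ * (u + v)) ^ 2 = Real.exp u * Real.exp v := by
      rw [← Real.exp_nat_mul, ← Real.exp_add]
      congr 1; push_cast; ring
    rw [mul_mul_mul_comm, mul_pow, ← ENNReal.ofReal_mul (by positivity),
      ← ENNReal.ofReal_pow (by positivity), e]
    gcongr
    exact H _ _ _ (by positivity) (by positivity) (by positivity) e

theorem lintegral_eq_Ioi_add_neg {f : ℝ → ℝ≥0∞} :
    ∫⁻ x, f x = (∫⁻ x in Set.Ioi 0, f x) + ∫⁻ x in Set.Ioi 0, f (-x) := by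
  have h1 : ∫⁻ x in Set.Ioi 0, f (-x) = ∫⁻ x in Set.Iio 0, f x := by
    have := (Measure.measurePreserving_neg (volume : Measure ℝ)).setLIntegral_comp_preimage_emb
      (MeasurableEquiv.neg ℝ).measurableEmbedding f (Set.Iio 0)
    simpa using this
  rw [h1, ← lintegral_add_compl f (measurableSet_Ioi (a := (0 : ℝ))), Set.compl_Ioi,
    setLIntegral_congr Iio_ae_eq_Iic]

theorem prekopa_leindler_geom_mean_real {f g h : ℝ → ℝ≥0∞} (hf : Measurable f) (hg : Measurable g)
    (hh : Measurable h)
    (H : ∀ x y z, z ^ 2 = |x * y| → f x * g y ≤ h z ^ 2) :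
    (∫⁻ x, f x) * (∫⁻ x, g x) ≤ (∫⁻ x, h x) ^ 2 := by
  rw [lintegral_eq_Ioi_add_neg (f := f), lintegral_eq_Ioi_add_neg (f := g),
    lintegral_eq_Ioi_add_neg (f := h)]
  have hf' : Measurable fun x => f (-x) := by fun_prop
  have hg' : Measurable fun x => g (-x) := by fun_prop
  have hh' : Measurable fun x => h (-x) := by fun_prop
  have R : ∀ x y z : ℝ, 0 < x → 0 < y → 0 < z → z ^ 2 = x * y → z ^ 2 = |x * y| :=
    fun x y z hx hy _ h => by rw [h, abs_of_pos (mul_pos hx hy)]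
  set A := ∫⁻ x in Set.Ioi 0, f x
  set A' := ∫⁻ x in Set.Ioi 0, f (-x)
  set B := ∫⁻ x in Set.Ioi 0, g x
  set B' := ∫⁻ x in Set.Ioi 0, g (-x)
  set C := ∫⁻ x in Set.Ioi 0, h x
  set C' := ∫⁻ x in Set.Ioi 0, h (-x)
  have key : ∀ D, (D = C ∨ D = C') → A * B ≤ D ^ 2 ∧ A * B' ≤ D ^ 2 ∧ A' * B ≤ D ^ 2 ∧
      A' * B' ≤ D ^ 2 := by
    rintro D (rfl | rfl)
    · refine ⟨prekopa_leindler_geom_mean_Ioi hf hg hh ?_,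
        prekopa_leindler_geom_mean_Ioi hf hg' hh ?_, prekopa_leindler_geom_mean_Ioi hf' hg hh ?_,
        prekopa_leindler_geom_mean_Ioi hf' hg' hh ?_⟩ <;> intro x y z hx hy hz hxy <;> apply H <;>
        simpa using R x y z hx hy hz hxy
    · refine ⟨prekopa_leindler_geom_mean_Ioi hf hg hh' ?_,
        prekopa_leindler_geom_mean_Ioi hf hg' hh' ?_, prekopa_leindler_geom_mean_Ioi hf' hg hh' ?_,
        prekopa_leindler_geom_mean_Ioi hf' hg' hh' ?_⟩ <;> intro x y z hx hy hz hxy <;> apply H <;>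
        simpa using R x y z hx hy hz hxy
  obtain ⟨h1, h2, h3, h4⟩ := key (min C C') (min_choice C C')
  calc (A + A') * (B + B') = A * B + A * B' + A' * B + A' * B' := by ring
    _ ≤ min C C' ^ 2 + min C C' ^ 2 + min C C' ^ 2 + min C C' ^ 2 := by gcongr
    _ = (min C C' + min C C') ^ 2 := by ring
    _ ≤ (C + C') ^ 2 := by
      gcongr
      · exact min_le_left _ _
      · exact min_le_right _ _

/-- Prékopa-Leindler inequality for coordinatewise geometric means of absolute values. -/
theorem prekopa_leindler_geom_mean_pi (n : ℕ) : ∀ {f g h : (Fin n → ℝ) → ℝ≥0∞}, Measurable f →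
    Measurable g →
    Measurable h →
    (∀ x y z : Fin n → ℝ, (∀ i, z i ^ 2 = |x i * y i|) → f x * g y ≤ h z ^ 2) →
    (∫⁻ x, f x) * (∫⁻ x, g x) ≤ (∫⁻ x, h x) ^ 2 := by
  induction n with
  | zero =>
    intro f g h hf hg hh H
    have e : ∀ f : (Fin 0 → ℝ) → ℝ≥0∞, ∫⁻ x, f x = f ![] := by
      intro f
      rw [lintegral_unique]
      have : (volume : Measure (Fin 0 → ℝ)) Set.univ = 1 := by simp [volume_pi]
      rw [this, mul_one]
      congr 1
    simp only [e]
    exact H _ _ _ (by simp)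
  | succ n ih =>
    intro f g h hf hg hh H
    have e : ∀ f : (Fin (n + 1) → ℝ) → ℝ≥0∞, Measurable f →
        ∫⁻ x, f x = ∫⁻ a : ℝ, ∫⁻ b : Fin n → ℝ, f (Fin.cons a b) := by
      intro f hf
      have hp := (volume_preserving_piFinSuccAbove (fun _ : Fin (n + 1) => ℝ) 0).symm
      rw [← hp.lintegral_comp hf, Measure.volume_eq_prod, lintegral_prod]
      · simp only [MeasurableEquiv.piFinSuccAbove_symm_apply, Fin.insertNthEquiv_zero]
        rfl
      · exact (hf.comp (MeasurableEquiv.measurable _)).aemeasurable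
    have hm : Measurable fun p : ℝ × (Fin n → ℝ) => (Fin.cons p.1 p.2 : Fin (n + 1) → ℝ) := by
      rw [measurable_pi_iff]
      intro i
      refine Fin.cases ?_ (fun j => ?_) i
      · simpa using measurable_fst
      · simp only [Fin.cons_succ]
        fun_prop
    have hm1 : ∀ a : ℝ, Measurable fun b : Fin n → ℝ => (Fin.cons a b : Fin (n + 1) → ℝ) :=
      fun a => hm.comp measurable_prodMk_left
    rw [e f hf, e g hg, e h hh]
    refine prekopa_leindler_geom_mean_real (hf.comp hm).lintegral_prod_right'
        (hg.comp hm).lintegral_prod_right'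
      (hh.comp hm).lintegral_prod_right' ?_
    intro a b c habc
    refine ih (hf.comp (hm1 a)) (hg.comp (hm1 b)) (hh.comp (hm1 c)) ?_
    intro x y z hxyz
    refine H _ _ _ fun i => ?_
    refine Fin.cases ?_ (fun j => ?_) i
    · simpa using habc
    · simpa using hxyz j

theorem cubic_le_exp_neg {t : ℝ} (ht : 0 ≤ t) : 1 - t + t ^ 2 / 2 - t ^ 3 ≤ Real.exp (-t) := by
  rcases le_total t 1 with h | h
  · have := Real.exp_bound (x := -t) (by rwa [abs_neg, abs_of_nonneg ht]) (n := 3) (by norm_num)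
    rw [abs_neg, abs_of_nonneg ht] at this
    norm_num [Finset.sum_range_succ, Nat.factorial] at this
    have h2 := (abs_le.1 this).1
    have h3 : 0 ≤ t ^ 3 := by positivity
    linarith
  · have := (Real.exp_pos (-t)).le
    nlinarith [mul_nonneg (sub_nonneg.2 h) (sq_nonneg t)]

open Filter Topology in
/-- If the Laplace transform of `W` is log-concave in the logarithm of its argument around `1`,
then the variance of `W` is at most its mean (stated for an unnormalized density `d`). -/
theorem variance_le_of_laplace {α : Type*} [MeasurableSpace α] {m : Measure α} {W d : α → ℝ}
    (hW : ∀ x, 0 ≤ W x) (hd : ∀ x, 0 ≤ d x)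
    (hi : ∀ k : ℕ, Integrable (fun x => W x ^ k * d x) m)
    (he : ∀ c : ℝ, Integrable (fun x => Real.exp (c * W x) * d x) m)
    (H : ∀ s > 0, (∫ x, Real.exp ((1 - s) * W x) * d x ∂m) *
      (∫ x, Real.exp ((1 - s⁻¹) * W x) * d x ∂m) ≤ (∫ x, d x ∂m) ^ 2) :
    (∫ x, d x ∂m) * (∫ x, W x ^ 2 * d x ∂m) - (∫ x, W x * d x ∂m) ^ 2
      ≤ (∫ x, d x ∂m) * ∫ x, W x * d x ∂m := by
  have i0 : Integrable d m := by simpa using hi 0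
  have i1 : Integrable (fun x => W x * d x) m := by simpa using hi 1
  have i2 := hi 2
  have i3 := hi 3
  have lo : ∀ t : ℝ, 0 ≤ t → (∫ x, d x ∂m) - t * (∫ x, W x * d x ∂m)
      + t ^ 2 / 2 * (∫ x, W x ^ 2 * d x ∂m) - t ^ 3 * (∫ x, W x ^ 3 * d x ∂m)
      ≤ ∫ x, Real.exp (-t * W x) * d x ∂m := by
    intro t ht
    have j1 : Integrable (fun x => d x - t * (W x * d x)) m := i0.sub (i1.const_mul _)
    have j2 : Integrable (fun x => d x - t * (W x * d x) + t ^ 2 / 2 * (W x ^ 2 * d x)) m :=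
      j1.add (i2.const_mul _)
    rw [← integral_const_mul, ← integral_const_mul, ← integral_const_mul,
      ← integral_sub i0 (i1.const_mul _), ← integral_add j1 (i2.const_mul _),
      ← integral_sub j2 (i3.const_mul _)]
    refine integral_mono (j2.sub (i3.const_mul _)) (he _) fun x => ?_
    have := mul_le_mul_of_nonneg_right (cubic_le_exp_neg (mul_nonneg ht (hW x))) (hd x)
    rw [neg_mul]
    refine le_trans (le_of_eq ?_) this
    ring
  have hi : ∀ t : ℝ, 0 ≤ t → (∫ x, d x ∂m) + t * (∫ x, W x * d x ∂m)
      + t ^ 2 / 2 * (∫ x, W x ^ 2 * d x ∂m) ≤ ∫ x, Real.exp (t * W x) * d x ∂m := by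
    intro t ht
    have j1 : Integrable (fun x => d x + t * (W x * d x)) m := i0.add (i1.const_mul _)
    rw [← integral_const_mul, ← integral_const_mul,
      ← integral_add i0 (i1.const_mul _), ← integral_add j1 (i2.const_mul _)]
    refine integral_mono (j1.add (i2.const_mul _)) (he _) fun x => ?_
    have := mul_le_mul_of_nonneg_right
      (Real.quadratic_le_exp_of_nonneg (mul_nonneg ht (hW x))) (hd x)
    refine le_trans (le_of_eq ?_) this
    ring
  have n0 : 0 ≤ ∫ x, d x ∂m := integral_nonneg hd
  have n1 : 0 ≤ ∫ x, W x * d x ∂m := integral_nonneg fun x => mul_nonneg (hW x) (hd x)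
  have n2 : 0 ≤ ∫ x, W x ^ 2 * d x ∂m :=
    integral_nonneg fun x => mul_nonneg (pow_nonneg (hW x) 2) (hd x)
  generalize (∫ x, d x ∂m) = Z at *
  generalize (∫ x, W x * d x ∂m) = I1 at *
  generalize (∫ x, W x ^ 2 * d x ∂m) = I2 at *
  generalize (∫ x, W x ^ 3 * d x ∂m) = I3 at *
  let p : ℝ → ℝ := fun δ => -Z * I1 * (1 + δ)
    + (Z - δ * I1 + δ ^ 2 / 2 * I2 - δ ^ 3 * I3) * I2 / 2
    + (-I1 + δ * I2 / 2 - δ ^ 2 * I3) * (1 + δ) * I1 + (I2 / 2 - δ * I3) * Z * (1 + δ) ^ 2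
  have hp : ∀ δ > 0, p δ ≤ 0 := by
    intro δ hδ
    have hu : 0 < 1 + δ := by linarith
    have h1 := lo δ hδ.le
    have h2 := hi (δ / (1 + δ)) (by positivity)
    have h3 := H (1 + δ) hu
    rw [show 1 - (1 + δ) = -δ by ring, show 1 - (1 + δ)⁻¹ = δ / (1 + δ) by field_simp; ring] at h3
    have hQ : 0 ≤ Z + δ / (1 + δ) * I1 + (δ / (1 + δ)) ^ 2 / 2 * I2 := by positivity
    have hE : 0 ≤ ∫ x, Real.exp (-δ * W x) * d x ∂m :=
      integral_nonneg fun x => mul_nonneg (Real.exp_pos _).le (hd x)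
    have h4 := (mul_le_mul h1 h2 hQ hE).trans h3
    have e : p δ * (δ ^ 2 / (1 + δ) ^ 2) = (Z - δ * I1 + δ ^ 2 / 2 * I2 - δ ^ 3 * I3) *
        (Z + δ / (1 + δ) * I1 + (δ / (1 + δ)) ^ 2 / 2 * I2) - Z ^ 2 := by
      simp only [p]
      field_simp
      ring
    have h5 : 0 < δ ^ 2 / (1 + δ) ^ 2 := by positivity
    by_contra! hc
    have := mul_pos hc h5
    linarith
  have hc : Continuous p := by fun_prop
  have ht : Tendsto p (𝓝[>] 0) (𝓝 (p 0)) := hc.continuousAt.tendsto.mono_left nhdsWithin_le_nhds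
  have := le_of_tendsto ht (eventually_mem_nhdsWithin.mono fun δ hδ => hp δ hδ)
  simp only [p] at this
  nlinarith

theorem setIntegral_mul_setIntegral_le_sq {n : ℕ} {B : Set (Fin n → ℝ)} (hB : MeasurableSet B)
    {f g h : (Fin n → ℝ) → ℝ} (hf : Measurable f) (hg : Measurable g) (hh : Measurable h)
    (hf0 : ∀ x, 0 ≤ f x) (hg0 : ∀ x, 0 ≤ g x) (hh0 : ∀ x, 0 ≤ h x)
    (hfi : IntegrableOn f B) (hgi : IntegrableOn g B) (hhi : IntegrableOn h B)
    (HB : ∀ x ∈ B, ∀ y ∈ B, ∀ z : Fin n → ℝ, (∀ i, z i ^ 2 = |x i * y i|) → z ∈ B)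
    (H : ∀ x y z : Fin n → ℝ, (∀ i, z i ^ 2 = |x i * y i|) → f x * g y ≤ h z ^ 2) :
    (∫ x in B, f x) * (∫ x in B, g x) ≤ (∫ x in B, h x) ^ 2 := by
  have P := prekopa_leindler_geom_mean_pi n (f := B.indicator fun x => ENNReal.ofReal (f x))
    (g := B.indicator fun x => ENNReal.ofReal (g x))
    (h := B.indicator fun x => ENNReal.ofReal (h x))
    (Measurable.indicator (by fun_prop) hB) (Measurable.indicator (by fun_prop) hB)
    (Measurable.indicator (by fun_prop) hB) (fun x y z hz => by
      by_cases hx : x ∈ B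
      · by_cases hy : y ∈ B
        · rw [Set.indicator_of_mem hx, Set.indicator_of_mem hy,
            Set.indicator_of_mem (HB x hx y hy z hz), ← ENNReal.ofReal_mul (hf0 x),
            ← ENNReal.ofReal_pow (hh0 z)]
          exact ENNReal.ofReal_le_ofReal (H x y z hz)
        · simp [hy]
      · simp [hx])
  rw [lintegral_indicator hB, lintegral_indicator hB, lintegral_indicator hB,
    ← ofReal_integral_eq_lintegral_ofReal hfi (.of_forall hf0),
    ← ofReal_integral_eq_lintegral_ofReal hgi (.of_forall hg0),
    ← ofReal_integral_eq_lintegral_ofReal hhi (.of_forall hh0),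
    ← ENNReal.ofReal_mul (integral_nonneg hf0), ← ENNReal.ofReal_pow (integral_nonneg hh0)] at P
  exact (ENNReal.ofReal_le_ofReal_iff (sq_nonneg _)).1 P

theorem integrableOn_sum_sq_lt {ι : Type*} [Fintype ι] (ρ : ℝ) {f : (ι → ℝ) → ℝ}
    (hf : Continuous f) : IntegrableOn f {x | ∑ i, x i ^ 2 < ρ} := by
  have hK : IsCompact {x : ι → ℝ | ∑ i, x i ^ 2 ≤ ρ} := by
    refine Metric.isCompact_of_isClosed_isBounded
      (isClosed_le (by fun_prop) continuous_const) ?_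
    refine (Metric.isBounded_closedBall (x := (0 : ι → ℝ)) (r := √ρ)).subset fun x hx => ?_
    rw [mem_closedBall_zero_iff, pi_norm_le_iff_of_nonneg (Real.sqrt_nonneg _)]
    intro i
    rw [Real.norm_eq_abs]
    refine Real.abs_le_sqrt (le_trans ?_ hx)
    exact Finset.single_le_sum (f := fun i => x i ^ 2) (fun i _ => sq_nonneg _) (Finset.mem_univ i)
  refine (hf.continuousOn.integrableOn_compact hK).mono_set fun x hx => ?_
  have hx : ∑ i, x i ^ 2 < ρ := hx
  exact hx.le

theorem two_mul_abs_mul_le_add {s : ℝ} (hs : 0 < s) (a b : ℝ) :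
    2 * |a * b| ≤ s * a ^ 2 + s⁻¹ * b ^ 2 := by
  have h : s * a ^ 2 + s⁻¹ * b ^ 2 - 2 * |a * b| = s⁻¹ * (s * |a| - |b|) ^ 2 := by
    rw [abs_mul, ← sq_abs a, ← sq_abs b]
    field_simp
    ring
  have := mul_nonneg (inv_pos.2 hs).le (sq_nonneg (s * |a| - |b|))
  linarith

theorem prod_stdPhi_eq {ι : Type*} [Fintype ι] {l : ι → ℝ} (hl : ∀ i, 0 < l i) (x : ι → ℝ) :
    ∏ i, (√(l i))⁻¹ * stdPhi ((√(l i))⁻¹ * x i)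
      = (∏ i, (√(l i))⁻¹ * (√(2 * Real.pi))⁻¹) * Real.exp (-∑ i, x i ^ 2 / (2 * l i)) := by
  rw [← Finset.sum_neg_distrib, Real.exp_sum, ← Finset.prod_mul_distrib]
  refine Finset.prod_congr rfl fun i _ => ?_
  rw [stdPhi, mul_assoc, mul_pow, inv_pow, Real.sq_sqrt (hl i).le]
  congr 3
  have := (hl i).ne'
  field_simp

/-- Variance inequality for N_ν(0, Λ) truncated to the Euclidean ball B(ρ):
var(X_n²) ≤ 2 λ_n E(X_n²) for each n. -/
theorem stmt19 (ν : ℕ) (l : Fin ν → ℝ) (hl : ∀ i, 0 < l i) (ρ : ℝ) (hρ : 0 < ρ)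
    (n : Fin ν) :
    let B : Set (Fin ν → ℝ) := {x | ∑ i, x i ^ 2 < ρ}
    let dens : (Fin ν → ℝ) → ℝ :=
      fun x => ∏ i, (Real.sqrt (l i))⁻¹ * stdPhi ((Real.sqrt (l i))⁻¹ * x i)
    let Z : ℝ := ∫ x in B, dens x
    (∫ x in B, x n ^ 4 * (Z⁻¹ * dens x)) -
        (∫ x in B, x n ^ 2 * (Z⁻¹ * dens x)) ^ 2
      ≤ 2 * l n * ∫ x in B, x n ^ 2 * (Z⁻¹ * dens x) := by
  intro B dens Z
  set W : (Fin ν → ℝ) → ℝ := fun x => x n ^ 2 / (2 * l n)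
  have hln := hl n
  set c := ∏ i, (√(l i))⁻¹ * (√(2 * Real.pi))⁻¹
  have hdens : ∀ x, dens x = c * Real.exp (-∑ i, x i ^ 2 / (2 * l i)) := prod_stdPhi_eq hl
  have hc : 0 < c := Finset.prod_pos fun i _ =>
    mul_pos (inv_pos.2 (Real.sqrt_pos.2 (hl i))) (by positivity)
  have hd0 : ∀ x, 0 ≤ dens x := fun x => by rw [hdens]; positivity
  have hdc : Continuous dens := by
    rw [funext hdens]
    fun_prop
  have hWc : Continuous W := by fun_prop
  have hW0 : ∀ x, 0 ≤ W x := fun x => by positivity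
  have hB : MeasurableSet B := measurableSet_lt (by fun_prop) measurable_const
  have HB : ∀ x ∈ B, ∀ y ∈ B, ∀ z : Fin ν → ℝ, (∀ i, z i ^ 2 = |x i * y i|) → z ∈ B := by
    intro x hx y hy z hz
    have hx : ∑ i, x i ^ 2 < ρ := hx
    have hy : ∑ i, y i ^ 2 < ρ := hy
    have h : 2 * ∑ i, z i ^ 2 ≤ ∑ i, x i ^ 2 + ∑ i, y i ^ 2 := by
      rw [Finset.mul_sum, ← Finset.sum_add_distrib]
      refine Finset.sum_le_sum fun i _ => ?_
      rw [hz i]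
      simpa using two_mul_abs_mul_le_add one_pos (x i) (y i)
    show ∑ i, z i ^ 2 < ρ
    linarith
  have V := variance_le_of_laplace (m := volume.restrict B) hW0 hd0
    (fun k => integrableOn_sum_sq_lt ρ (by fun_prop))
    (fun t => integrableOn_sum_sq_lt ρ (by fun_prop)) (fun s hs => by
      refine setIntegral_mul_setIntegral_le_sq hB (by fun_prop) (by fun_prop) (by fun_prop)
        (fun x => mul_nonneg (Real.exp_pos _).le (hd0 x))
        (fun x => mul_nonneg (Real.exp_pos _).le (hd0 x)) hd0
        (integrableOn_sum_sq_lt ρ (by fun_prop)) (integrableOn_sum_sq_lt ρ (by fun_prop))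
        (integrableOn_sum_sq_lt ρ hdc) HB ?_
      intro x y z hz
      rw [hdens, hdens, hdens, mul_left_comm _ c, mul_left_comm _ c, mul_mul_mul_comm,
        mul_pow, ← sq, ← Real.exp_add, ← Real.exp_add, ← Real.exp_add, ← Real.exp_nat_mul]
      refine mul_le_mul_of_nonneg_left (Real.exp_le_exp.2 ?_) (sq_nonneg c)
      have e : ∀ (t : ℝ) (x : Fin ν → ℝ),
          (1 - t) * W x = ∑ i, if i = n then (1 - t) * (x i ^ 2 / (2 * l i)) else 0 := by
        intro t x
        simp [W]
      rw [e, e, ← Finset.sum_neg_distrib, ← Finset.sum_neg_distrib, ← Finset.sum_neg_distrib,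
        ← Finset.sum_add_distrib, ← Finset.sum_add_distrib, ← Finset.sum_add_distrib,
        Finset.mul_sum]
      refine Finset.sum_le_sum fun i _ => ?_
      rw [hz i]
      have hi := hl i
      split_ifs with hin
      · have := div_le_div_of_nonneg_right (two_mul_abs_mul_le_add hs (x i) (y i))
          (show 0 ≤ 2 * l i by positivity)
        push_cast
        linear_combination this
      · have := div_le_div_of_nonneg_right (two_mul_abs_mul_le_add one_pos (x i) (y i))
          (show 0 ≤ 2 * l i by positivity)
        push_cast
        linear_combination this)
  have e2 : ∫ x in B, x n ^ 2 * (Z⁻¹ * dens x) = 2 * l n * Z⁻¹ * ∫ x in B, W x * dens x := by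
    rw [← integral_const_mul]
    congr 1
    ext x
    simp only [W]
    field_simp
  have e4 : ∫ x in B, x n ^ 4 * (Z⁻¹ * dens x)
      = (2 * l n) ^ 2 * Z⁻¹ * ∫ x in B, W x ^ 2 * dens x := by
    rw [← integral_const_mul]
    congr 1
    ext x
    simp only [W]
    field_simp
  rw [e2, e4]
  change Z * _ - _ ≤ Z * _ at V
  rcases eq_or_ne Z 0 with hZ | hZ
  · simp [hZ]
  have := mul_le_mul_of_nonneg_left V (sq_nonneg (2 * l n * Z⁻¹))
  have hz : Z⁻¹ ^ 2 * Z = Z⁻¹ := by field_simp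
  linear_combination this + (2 * l n) ^ 2 * ((∫ x in B, W x * dens x) -
    (∫ x in B, W x ^ 2 * dens x)) * hz
end
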